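/- arXiv:1805.04959 — 2 statements merged into one kernel-verified Lean document; each statement's English description precedes it below -/
import Mathlib

section
/- Let d ≥ 1, N ≥ 2, ω ∈ ℝ, η ∈ ℝ with η ≠ 0, and γ ∈ ℝ. Let B₀ ∈ ℝ^{dN×dN} be the block matrix whose diagonal d×d blocks equal −(ω² + ((N−1)/N)η²)·I_d and whose off-diagonal d×d blocks equal (η²/N)·I_d, and let B = [[0, I_{dN}],[B₀, −γI_{dN}]] ∈ ℂ^{2dN×2dN}. Then α ∈ ℂ is an eigenvalue of B if and only if α² + γα + ω² = 0 or α² + γα + (ω²+η²) = 0; equivalently, the spectrum of B equals {(−γ ± √(γ²−4ω²))/2} ∪ {(−γ ± √(γ²−4(ω²+η²)))/2}, where the square roots are taken in ℂ. -/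
open Matrix

theorem Matrix.mem_spectrum_iff_exists_mulVec {K n : Type*} [Field K] [Fintype n] [DecidableEq n]
    (A : Matrix n n K) (μ : K) : μ ∈ spectrum K A ↔ ∃ v ≠ 0, A *ᵥ v = μ • v := by
  rw [← Matrix.spectrum_toLin', ← Module.End.hasEigenvalue_iff_mem_spectrum]
  constructor
  · rintro h
    obtain ⟨v, hv⟩ := h.exists_hasEigenvector
    exact ⟨v, hv.2, by simpa using hv.apply_eq_smul⟩
  · rintro ⟨v, hv0, hv⟩
    exact Module.End.hasEigenvalue_of_hasEigenvector
      (Module.End.hasEigenvector_iff.2 ⟨Module.End.mem_eigenspace_iff.2 (by simpa using hv), hv0⟩)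

/-- The eigenvalues of the block companion matrix of `X ^ 2 - c X - A` are the roots `α` of
`α ^ 2 - c * α = μ`, with `μ` an eigenvalue of `A`. -/
theorem Matrix.mem_spectrum_fromBlocks_zero_one_smul_one {K n : Type*} [Field K] [Fintype n]
    [DecidableEq n] (A : Matrix n n K) (c α : K) :
    α ∈ spectrum K (fromBlocks 0 (1 : Matrix n n K) A (c • (1 : Matrix n n K))) ↔
      α ^ 2 - c * α ∈ spectrum K A := by
  simp only [Matrix.mem_spectrum_iff_exists_mulVec]
  constructor
  · rintro ⟨v, hv0, hv⟩
    rw [fromBlocks_mulVec] at hv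
    have hl (i : n) : v (.inr i) = α * v (.inl i) := by simpa using congrFun hv (.inl i)
    have hr (i : n) : (A *ᵥ (v ∘ Sum.inl)) i + c * v (.inr i) = α * v (.inr i) := by
      simpa [smul_mulVec] using congrFun hv (.inr i)
    refine ⟨v ∘ Sum.inl, fun h => hv0 ?_, ?_⟩
    · have hz (i : n) : v (.inl i) = 0 := congrFun h i
      ext (i | i) <;> simp [hl, hz]
    · ext i
      have h := hr i
      simp only [hl] at h
      simp only [Pi.smul_apply, Function.comp_apply, smul_eq_mul]
      linear_combination h
  · rintro ⟨x, hx0, hx⟩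
    refine ⟨Sum.elim x (α • x), fun h => hx0 ?_, ?_⟩
    · ext i
      exact congrFun h (.inl i)
    · rw [fromBlocks_mulVec]
      ext (i | i)
      · simp
      · have h := congrFun hx i
        simp only [Pi.smul_apply, smul_eq_mul] at h
        simp [smul_mulVec, h]
        ring

/-- The spectrum of the block matrix with diagonal blocks `p • 1` and off-diagonal blocks
`q • 1`. -/
theorem Matrix.mem_spectrum_of_mean_field {K m n : Type*} [Field K] [Fintype m] [DecidableEq m]
    [Nontrivial m] [Fintype n] [DecidableEq n] [Nonempty n] (A : Matrix (m × n) (m × n) K) (p q : K)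
    (hA : ∀ i j a b, A (i, a) (j, b) = (if i = j then p else q) * (if a = b then 1 else 0))
    (μ : K) : μ ∈ spectrum K A ↔ μ = p - q ∨ μ = p - q + Fintype.card m * q := by
  have hmul (v : m × n → K) (i : m) (a : n) :
      (A *ᵥ v) (i, a) = (p - q) * v (i, a) + q * ∑ j, v (j, a) := by
    have hif (j : m) : (if i = j then p else q) = (if i = j then p - q else 0) + q := by
      split_ifs <;> ring
    simp [mulVec, dotProduct, Fintype.sum_prod_type, hA, hif, add_mul, Finset.sum_add_distrib,
      Finset.mul_sum]
  rw [Matrix.mem_spectrum_iff_exists_mulVec]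
  constructor
  · rintro ⟨v, hv0, hv⟩
    have h (i : m) (a : n) : (p - q) * v (i, a) + q * ∑ j, v (j, a) = μ * v (i, a) := by
      rw [← hmul, hv]
      rfl
    by_contra! hμ
    refine hv0 (funext fun ⟨i, a⟩ => ?_)
    have hs : ∑ j, v (j, a) = 0 := by
      have hsum := Finset.sum_congr rfl fun i (_ : i ∈ Finset.univ) => h i a
      simp only [Finset.sum_add_distrib, ← Finset.mul_sum, Finset.sum_const, Finset.card_univ,
        nsmul_eq_mul] at hsum
      refine (mul_eq_zero.1 ?_).resolve_left (sub_ne_zero.2 hμ.2)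
      linear_combination -hsum
    refine (mul_eq_zero.1 ?_).resolve_left (sub_ne_zero.2 hμ.1)
    linear_combination -h i a + q * hs
  · obtain ⟨a⟩ := ‹Nonempty n›
    obtain ⟨i, j, hij⟩ := exists_pair_ne m
    rintro (rfl | rfl)
    · refine ⟨fun x => (Pi.single i 1 - Pi.single j 1 : m → K) x.1, fun h => ?_, ?_⟩
      · simpa [hij] using congrFun h (i, a)
      · ext ⟨k, b⟩
        rw [hmul]
        simp
    · refine ⟨1, fun h => one_ne_zero (congrFun h (i, a)), ?_⟩
      ext ⟨k, b⟩
      rw [hmul]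
      simp
      ring

theorem sq_add_mul_add_eq_zero_iff_exists_sq {K : Type*} [Field K] [NeZero (2 : K)] (b c α : K) :
    α ^ 2 + b * α + c = 0 ↔ ∃ w : K, w ^ 2 = b ^ 2 - 4 * c ∧ α = (-b + w) / 2 := by
  have h2 : (2 : K) ≠ 0 := two_ne_zero
  constructor
  · intro h
    refine ⟨2 * α + b, by linear_combination 4 * h, ?_⟩
    field_simp
    ring
  · rintro ⟨w, hw, rfl⟩
    field_simp
    linear_combination hw

theorem stmt_2 (d N : ℕ) (hd : 1 ≤ d) (hN : 2 ≤ N) (ω η γ : ℝ) (hη : η ≠ 0)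
    (B₀ : Matrix (Fin N × Fin d) (Fin N × Fin d) ℝ)
    (hB₀ : ∀ (i j : Fin N) (a b : Fin d),
      B₀ (i, a) (j, b) =
        (if i = j then -(ω ^ 2 + ((N : ℝ) - 1) / N * η ^ 2) else η ^ 2 / N) *
          (if a = b then 1 else 0))
    (B : Matrix ((Fin N × Fin d) ⊕ (Fin N × Fin d)) ((Fin N × Fin d) ⊕ (Fin N × Fin d)) ℂ)
    (hB : B = Matrix.fromBlocks 0 1 (B₀.map (algebraMap ℝ ℂ))
        ((-(γ : ℂ)) • (1 : Matrix (Fin N × Fin d) (Fin N × Fin d) ℂ))) :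
    (∀ α : ℂ, α ∈ spectrum ℂ B ↔
        (α ^ 2 + (γ : ℂ) * α + (ω : ℂ) ^ 2 = 0 ∨
          α ^ 2 + (γ : ℂ) * α + ((ω : ℂ) ^ 2 + (η : ℂ) ^ 2) = 0)) ∧
      spectrum ℂ B =
        {α : ℂ | ∃ w : ℂ, w ^ 2 = (γ : ℂ) ^ 2 - 4 * (ω : ℂ) ^ 2 ∧ α = (-(γ : ℂ) + w) / 2} ∪
          {α : ℂ | ∃ w : ℂ, w ^ 2 = (γ : ℂ) ^ 2 - 4 * ((ω : ℂ) ^ 2 + (η : ℂ) ^ 2) ∧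
            α = (-(γ : ℂ) + w) / 2} := by
  have hfirst (α : ℂ) : α ∈ spectrum ℂ B ↔
      (α ^ 2 + (γ : ℂ) * α + (ω : ℂ) ^ 2 = 0 ∨
        α ^ 2 + (γ : ℂ) * α + ((ω : ℂ) ^ 2 + (η : ℂ) ^ 2) = 0) := by
    have : Nontrivial (Fin N) := Fin.nontrivial_iff_two_le.2 hN
    have : Nonempty (Fin d) := ⟨⟨0, hd⟩⟩
    have hN0 : (N : ℂ) ≠ 0 := by
      exact_mod_cast (by omega : N ≠ 0)
    rw [hB, Matrix.mem_spectrum_fromBlocks_zero_one_smul_one,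
      Matrix.mem_spectrum_of_mean_field (B₀.map (algebraMap ℝ ℂ))
        (-((ω : ℂ) ^ 2 + ((N : ℂ) - 1) / N * (η : ℂ) ^ 2)) ((η : ℂ) ^ 2 / N)
        (fun i j a b => by
          rw [map_apply, hB₀]
          split_ifs <;> simp)]
    have hp : -((ω : ℂ) ^ 2 + ((N : ℂ) - 1) / N * (η : ℂ) ^ 2) - (η : ℂ) ^ 2 / N =
        -((ω : ℂ) ^ 2 + (η : ℂ) ^ 2) := by
      field_simp
      ring
    rw [hp, Fintype.card_fin, mul_div_cancel₀ _ hN0, or_comm]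
    refine or_congr ⟨fun h => ?_, fun h => ?_⟩ ⟨fun h => ?_, fun h => ?_⟩ <;>
      linear_combination h
  refine ⟨hfirst, Set.ext fun α => ?_⟩
  rw [hfirst, sq_add_mul_add_eq_zero_iff_exists_sq, sq_add_mul_add_eq_zero_iff_exists_sq]
  rfl
end

section
/- Let d, m ≥ 1, β > 0 and V, U : ℝ^d → ℝ measurable. Let ρ : X → [0,∞) be a probability density on X = ℝ^d × ℝ^d × ℝ^{dm}, where (U∗ρ)(q) := ∫_X U(q−q′)ρ(q′,p′,z′)dq′dp′dz′ and, for a probability density h on ℝ^d, (U⋆h)(q) := ∫_{ℝ^d} U(q−q′)h(q′)dq′. Assume the normalization integrals below are finite and positive. Then ρ satisfies ρ(q,p,z) = exp[−β(|p|²/2 + ‖z‖²/2 + V(q) + (U∗ρ)(q))] / ∫_X exp[−β(|p′|²/2 + ‖z′‖²/2 + V(q′) + (U∗ρ)(q′))] dq′dp′dz′ if and only if ρ(q,p,z) = g_β(p) · G_β(z) · h(q), where g_β(p) = e^{−β|p|²/2}/∫_{ℝ^d} e^{−β|p′|²/2}dp′, G_β(z) = e^{−β‖z‖²/2}/∫_{ℝ^{dm}}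 e^{−β‖z′‖²/2}dz′, and h is a probability density on ℝ^d satisfying h(q) = exp[−β(V(q) + (U⋆h)(q))] / ∫_{ℝ^d} exp[−β(V(q′) + (U⋆h)(q′))] dq′. Consequently the map h ↦ g_β G_β h is a bijection between solutions of the overdamped self-consistency equation and solutions of the generalized one, so the overdamped, underdamped and generalized McKean–Vlasov equations have the same number of stationary states. -/
open Matrix MeasureTheory Real

/-- Extended phase space `X = ℝ^d × ℝ^d × ℝ^{dm}` with coordinates `x = (q, p, z)`. -/
abbrev Phase (d m : ℕ) := (Fin d → ℝ) × (Fin d → ℝ) × (Fin (d * m) → ℝ)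

/-- Convolution `(U ∗ ρ)(q) = ∫_X U(q − q′) ρ(q′,p′,z′) dq′dp′dz′` of `U` with a density on
the extended phase space. -/
noncomputable def convX (d m : ℕ) (U : (Fin d → ℝ) → ℝ) (ρ : Phase d m → ℝ)
    (q : Fin d → ℝ) : ℝ :=
  ∫ x' : Phase d m, U (q - x'.1) * ρ x'

/-- Convolution `(U ⋆ h)(q) = ∫_{ℝ^d} U(q − q′) h(q′) dq′` of `U` with a density on `ℝ^d`. -/
noncomputable def convD (d : ℕ) (U : (Fin d → ℝ) → ℝ) (h : (Fin d → ℝ) → ℝ)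
    (q : Fin d → ℝ) : ℝ :=
  ∫ q' : Fin d → ℝ, U (q - q') * h q'

/-- The normalized Gaussian `g_β(p) = e^{−β|p|²/2} / ∫ e^{−β|p′|²/2} dp′` in the momentum
variable. -/
noncomputable def gaussP (d : ℕ) (β : ℝ) (p : Fin d → ℝ) : ℝ :=
  Real.exp (-β * ((∑ i, p i ^ 2) / 2)) /
    ∫ p' : Fin d → ℝ, Real.exp (-β * ((∑ i, p' i ^ 2) / 2))

/-- The normalized Gaussian `G_β(z) = e^{−β‖z‖²/2} / ∫ e^{−β‖z′‖²/2} dz′` in the auxiliary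
variable. -/
noncomputable def gaussZ (d m : ℕ) (β : ℝ) (z : Fin (d * m) → ℝ) : ℝ :=
  Real.exp (-β * ((∑ j, z j ^ 2) / 2)) /
    ∫ z' : Fin (d * m) → ℝ, Real.exp (-β * ((∑ j, z' j ^ 2) / 2))

/-- `h` is a probability density on `ℝ^d` solving the overdamped self-consistency equation
`h = e^{−β(V + U⋆h)} / ∫ e^{−β(V + U⋆h)}`, with finite positive normalization integral. -/
noncomputable def IsOverdampedStat (d : ℕ) (β : ℝ) (V U : (Fin d → ℝ) → ℝ)
    (h : (Fin d → ℝ) → ℝ) : Prop :=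
  (∀ q, 0 ≤ h q) ∧ Integrable h ∧ (∫ q : Fin d → ℝ, h q) = 1 ∧
    Integrable (fun q : Fin d → ℝ => Real.exp (-β * (V q + convD d U h q))) ∧
    (0 < ∫ q' : Fin d → ℝ, Real.exp (-β * (V q' + convD d U h q'))) ∧
    ∀ q, h q = Real.exp (-β * (V q + convD d U h q)) /
      ∫ q' : Fin d → ℝ, Real.exp (-β * (V q' + convD d U h q'))

/-- `ρ` is a probability density on the extended phase space solving the generalized
self-consistency equation, with finite positive normalization integral. -/
noncomputable def IsGeneralizedStat (d m : ℕ) (β : ℝ) (V U : (Fin d → ℝ) → ℝ)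
    (ρ : Phase d m → ℝ) : Prop :=
  (∀ x, 0 ≤ ρ x) ∧ Integrable ρ ∧ (∫ x : Phase d m, ρ x) = 1 ∧
    Integrable (fun x : Phase d m => Real.exp (-β * ((∑ i, x.2.1 i ^ 2) / 2
      + (∑ j, x.2.2 j ^ 2) / 2 + V x.1 + convX d m U ρ x.1))) ∧
    (0 < ∫ x' : Phase d m, Real.exp (-β * ((∑ i, x'.2.1 i ^ 2) / 2
      + (∑ j, x'.2.2 j ^ 2) / 2 + V x'.1 + convX d m U ρ x'.1))) ∧
    ∀ x : Phase d m, ρ x = Real.exp (-β * ((∑ i, x.2.1 i ^ 2) / 2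
      + (∑ j, x.2.2 j ^ 2) / 2 + V x.1 + convX d m U ρ x.1)) /
      ∫ x' : Phase d m, Real.exp (-β * ((∑ i, x'.2.1 i ^ 2) / 2
        + (∑ j, x'.2.2 j ^ 2) / 2 + V x'.1 + convX d m U ρ x'.1))

/-- The extended density `(q, p, z) ↦ g_β(p) G_β(z) h(q)` built from a density `h` in `q`. -/
noncomputable def extendDensity (d m : ℕ) (β : ℝ) (h : (Fin d → ℝ) → ℝ) : Phase d m → ℝ :=
  fun x => gaussP d β x.2.1 * gaussZ d m β x.2.2 * h x.1

theorem integral_triple_mul {α γ δ : Type*} [MeasureSpace α] [MeasureSpace γ] [MeasureSpace δ]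
    [SFinite (volume : Measure α)] [SFinite (volume : Measure γ)] [SFinite (volume : Measure δ)]
    (f : α → ℝ) (g : γ → ℝ) (k : δ → ℝ) :
    ∫ x : α × γ × δ, f x.1 * (g x.2.1 * k x.2.2) =
      (∫ a, f a) * ((∫ b, g b) * ∫ c, k c) := by
  rw [← integral_prod_mul g k]
  exact integral_prod_mul f (fun y : γ × δ => g y.1 * k y.2)

theorem Integrable.left_of_prod_mul {α γ : Type*} [MeasureSpace α] [MeasureSpace γ]
    [SFinite (volume : Measure α)] [SFinite (volume : Measure γ)]
    [NeZero (volume : Measure γ)] {f : α → ℝ} {g : γ → ℝ} (hg : ∀ y, g y ≠ 0)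
    (h : Integrable fun x : α × γ => f x.1 * g x.2) : Integrable f := by
  obtain ⟨y, hy⟩ := (Integrable.prod_left_ae h).exists
  simpa [mul_assoc, hg y] using hy.mul_const (g y)⁻¹

theorem exp_energy_eq (d m : ℕ) (β : ℝ) (V c : (Fin d → ℝ) → ℝ) (x : Phase d m) :
    Real.exp (-β * ((∑ i, x.2.1 i ^ 2) / 2 + (∑ j, x.2.2 j ^ 2) / 2 + V x.1 + c x.1)) =
      Real.exp (-β * (V x.1 + c x.1)) * (Real.exp (-β * ((∑ i, x.2.1 i ^ 2) / 2)) *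
        Real.exp (-β * ((∑ j, x.2.2 j ^ 2) / 2))) := by
  rw [← Real.exp_add, ← Real.exp_add]
  congr 1
  ring

theorem integral_gaussP (d : ℕ) (β : ℝ)
    (hpos : 0 < ∫ p : Fin d → ℝ, Real.exp (-β * ((∑ i, p i ^ 2) / 2))) :
    ∫ p, gaussP d β p = 1 := by
  simp only [gaussP]
  rw [integral_div, div_self hpos.ne']

theorem integral_gaussZ (d m : ℕ) (β : ℝ)
    (hpos : 0 < ∫ z : Fin (d * m) → ℝ, Real.exp (-β * ((∑ j, z j ^ 2) / 2))) :
    ∫ z, gaussZ d m β z = 1 := by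
  simp only [gaussZ]
  rw [integral_div, div_self hpos.ne']

theorem convX_extendDensity (d m : ℕ) (β : ℝ)
    (hgP : 0 < ∫ p : Fin d → ℝ, Real.exp (-β * ((∑ i, p i ^ 2) / 2)))
    (hgZ : 0 < ∫ z : Fin (d * m) → ℝ, Real.exp (-β * ((∑ j, z j ^ 2) / 2)))
    (U h : (Fin d → ℝ) → ℝ) :
    convX d m U (extendDensity d m β h) = convD d U h := by
  funext q
  have key := integral_triple_mul (fun q' => U (q - q') * h q') (gaussP d β) (gaussZ d m β)
  rw [integral_gaussP d β hgP, integral_gaussZ d m β hgZ, mul_one, mul_one] at key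
  rw [convX, convD, ← key]
  congr 1
  funext x
  simp only [extendDensity]
  ring

theorem isGeneralizedStat_extendDensity {d m : ℕ} {β : ℝ} {V U h : (Fin d → ℝ) → ℝ}
    (hgPint : Integrable fun p : Fin d → ℝ => Real.exp (-β * ((∑ i, p i ^ 2) / 2)))
    (hgP : 0 < ∫ p : Fin d → ℝ, Real.exp (-β * ((∑ i, p i ^ 2) / 2)))
    (hgZint : Integrable fun z : Fin (d * m) → ℝ => Real.exp (-β * ((∑ j, z j ^ 2) / 2)))
    (hgZ : 0 < ∫ z : Fin (d * m) → ℝ, Real.exp (-β * ((∑ j, z j ^ 2) / 2)))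
    (hh : IsOverdampedStat d β V U h) :
    IsGeneralizedStat d m β V U (extendDensity d m β h) := by
  obtain ⟨h0, hint, hmass, hEint, hEpos, heq⟩ := hh
  have hform : extendDensity d m β h =
      fun x => h x.1 * (gaussP d β x.2.1 * gaussZ d m β x.2.2) := by
    funext x
    simp only [extendDensity]
    ring
  unfold IsGeneralizedStat
  simp only [convX_extendDensity d m β hgP hgZ, exp_energy_eq d m β V (convD d U h)]
  rw [integral_triple_mul (fun q => Real.exp (-β * (V q + convD d U h q)))
    (fun p : Fin d → ℝ => Real.exp (-β * ((∑ i, p i ^ 2) / 2)))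
    (fun z : Fin (d * m) → ℝ => Real.exp (-β * ((∑ j, z j ^ 2) / 2)))]
  refine ⟨fun x => ?_, ?_, ?_, hEint.mul_prod (hgPint.mul_prod hgZint), by positivity,
    fun x => ?_⟩
  · exact mul_nonneg (mul_nonneg (div_nonneg (Real.exp_pos _).le hgP.le)
      (div_nonneg (Real.exp_pos _).le hgZ.le)) (h0 _)
  · rw [hform]
    exact hint.mul_prod ((hgPint.div_const _).mul_prod (hgZint.div_const _))
  · rw [hform, integral_triple_mul h, hmass, integral_gaussP d β hgP, integral_gaussZ d m β hgZ]
    norm_num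
  · simp only [extendDensity, gaussP, gaussZ]
    rw [heq x.1]
    field_simp

theorem IsGeneralizedStat.exists_extendDensity {d m : ℕ} {β : ℝ} {V U : (Fin d → ℝ) → ℝ}
    {ρ : Phase d m → ℝ}
    (hgP : 0 < ∫ p : Fin d → ℝ, Real.exp (-β * ((∑ i, p i ^ 2) / 2)))
    (hgZ : 0 < ∫ z : Fin (d * m) → ℝ, Real.exp (-β * ((∑ j, z j ^ 2) / 2)))
    (hρ : IsGeneralizedStat d m β V U ρ) :
    ∃ h, IsOverdampedStat d β V U h ∧ ρ = extendDensity d m β h := by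
  obtain ⟨-, -, -, hEint, hEpos, heq⟩ := hρ
  simp only [exp_energy_eq d m β V (convX d m U ρ)] at hEint hEpos heq
  rw [integral_triple_mul (fun q => Real.exp (-β * (V q + convX d m U ρ q)))
    (fun p : Fin d → ℝ => Real.exp (-β * ((∑ i, p i ^ 2) / 2)))
    (fun z : Fin (d * m) → ℝ => Real.exp (-β * ((∑ j, z j ^ 2) / 2)))] at hEpos heq
  have hIpos : 0 < ∫ q, Real.exp (-β * (V q + convX d m U ρ q)) :=
    pos_of_mul_pos_left hEpos (mul_pos hgP hgZ).le
  have hIint : Integrable fun q => Real.exp (-β * (V q + convX d m U ρ q)) :=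
    Integrable.left_of_prod_mul
      (g := fun y : (Fin d → ℝ) × (Fin (d * m) → ℝ) => Real.exp (-β * ((∑ i, y.1 i ^ 2) / 2)) *
        Real.exp (-β * ((∑ j, y.2 j ^ 2) / 2))) (fun y => by positivity) hEint
  let h : (Fin d → ℝ) → ℝ := fun q => Real.exp (-β * (V q + convX d m U ρ q)) /
    ∫ q', Real.exp (-β * (V q' + convX d m U ρ q'))
  have hρh : ρ = extendDensity d m β h := by
    funext x
    rw [heq x]
    simp only [extendDensity, gaussP, gaussZ, h]
    field_simp
  have hconv : convX d m U ρ = convD d U h := by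
    conv_lhs => rw [hρh]
    exact convX_extendDensity d m β hgP hgZ U h
  refine ⟨h, ⟨fun q => div_nonneg (Real.exp_pos _).le hIpos.le, hIint.div_const _, ?_, ?_, ?_,
    fun q => ?_⟩, hρh⟩
  · simp only [h]
    rw [integral_div, div_self hIpos.ne']
  · rwa [← hconv]
  · rwa [← hconv]
  · rw [← hconv]

theorem extendDensity_injective {d m : ℕ} {β : ℝ}
    (hgP : 0 < ∫ p : Fin d → ℝ, Real.exp (-β * ((∑ i, p i ^ 2) / 2)))
    (hgZ : 0 < ∫ z : Fin (d * m) → ℝ, Real.exp (-β * ((∑ j, z j ^ 2) / 2))) :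
    Function.Injective (extendDensity d m β) := by
  intro h₁ h₂ heq
  funext q
  have hP : 0 < gaussP d β 0 := div_pos (Real.exp_pos _) hgP
  have hZ : 0 < gaussZ d m β 0 := div_pos (Real.exp_pos _) hgZ
  exact mul_left_cancel₀ (mul_pos hP hZ).ne' (congrFun heq (q, 0, 0))

theorem stmt_10 (d m : ℕ) (hd : 1 ≤ d) (hm : 1 ≤ m) (β : ℝ) (hβ : 0 < β)
    (V U : (Fin d → ℝ) → ℝ) (hV : Measurable V) (hU : Measurable U)
    -- the Gaussian normalization integrals are finite and positive
    (hgPint : Integrable fun p : Fin d → ℝ => Real.exp (-β * ((∑ i, p i ^ 2) / 2)))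
    (hgPpos : 0 < ∫ p : Fin d → ℝ, Real.exp (-β * ((∑ i, p i ^ 2) / 2)))
    (hgZint : Integrable fun z : Fin (d * m) → ℝ => Real.exp (-β * ((∑ j, z j ^ 2) / 2)))
    (hgZpos : 0 < ∫ z : Fin (d * m) → ℝ, Real.exp (-β * ((∑ j, z j ^ 2) / 2)))
    -- `ρ` is a probability density with finite positive normalization integral
    (ρ : Phase d m → ℝ) (hρ_nonneg : ∀ x, 0 ≤ ρ x) (hρ_int : Integrable ρ)
    (hρ_mass : (∫ x : Phase d m, ρ x) = 1)
    (hZint : Integrable (fun x : Phase d m => Real.exp (-β * ((∑ i, x.2.1 i ^ 2) / 2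
      + (∑ j, x.2.2 j ^ 2) / 2 + V x.1 + convX d m U ρ x.1))))
    (hZpos : 0 < ∫ x' : Phase d m, Real.exp (-β * ((∑ i, x'.2.1 i ^ 2) / 2
      + (∑ j, x'.2.2 j ^ 2) / 2 + V x'.1 + convX d m U ρ x'.1))) :
    ((∀ x : Phase d m, ρ x = Real.exp (-β * ((∑ i, x.2.1 i ^ 2) / 2
        + (∑ j, x.2.2 j ^ 2) / 2 + V x.1 + convX d m U ρ x.1)) /
        ∫ x' : Phase d m, Real.exp (-β * ((∑ i, x'.2.1 i ^ 2) / 2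
          + (∑ j, x'.2.2 j ^ 2) / 2 + V x'.1 + convX d m U ρ x'.1))) ↔
      (∃ h : (Fin d → ℝ) → ℝ, IsOverdampedStat d β V U h ∧
        ∀ x : Phase d m, ρ x = gaussP d β x.2.1 * gaussZ d m β x.2.2 * h x.1)) ∧
    Set.BijOn
      (fun (h : (Fin d → ℝ) → ℝ) => fun x : Phase d m =>
        gaussP d β x.2.1 * gaussZ d m β x.2.2 * h x.1)
      {h | IsOverdampedStat d β V U h} {ρ' | IsGeneralizedStat d m β V U ρ'} := by
  refine ⟨⟨fun heq => ?_, ?_⟩, ?_, ?_, ?_⟩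
  · obtain ⟨h, hh, hρ⟩ := IsGeneralizedStat.exists_extendDensity hgPpos hgZpos
      ⟨hρ_nonneg, hρ_int, hρ_mass, hZint, hZpos, heq⟩
    exact ⟨h, hh, congrFun hρ⟩
  · rintro ⟨h, hh, hρ⟩
    obtain rfl : ρ = extendDensity d m β h := funext hρ
    exact (isGeneralizedStat_extendDensity hgPint hgPpos hgZint hgZpos hh).2.2.2.2.2
  · exact fun h hh => isGeneralizedStat_extendDensity hgPint hgPpos hgZint hgZpos hh
  · exact (extendDensity_injective hgPpos hgZpos).injOn
  · intro ρ' hρ'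
    obtain ⟨h, hh, hρ⟩ := IsGeneralizedStat.exists_extendDensity hgPpos hgZpos hρ'
    exact ⟨h, hh, hρ.symm⟩
end
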